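/- Fixed point of the diatomic Bellman operator: let α ∈ (0,1) and π ∈ Π. There exists a unique 𝒬^π = (Q₁^π, Q₂^π) : X×A → ℝ² such that 𝒬^π = T^π_α 𝒬^π. -/

import Mathlib

open MeasureTheory ProbabilityTheory Finset Set

noncomputable section

/-- Quantile (generalized inverse distribution) function of a measure on `ℝ`. -/
def quantileFn (ν : Measure ℝ) (τ : ℝ) : ℝ :=
  sInf {z : ℝ | τ ≤ cdf ν z}

/-- Left average value-at-risk at level `α`. -/
def avarLeft (α : ℝ) (ν : Measure ℝ) : ℝ :=
  (1 / α) * ∫ τ in (0:ℝ)..α, quantileFn ν τ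

/-- Right average value-at-risk at level `1 - α`. -/
def avarRight (α : ℝ) (ν : Measure ℝ) : ℝ :=
  (1 / (1 - α)) * ∫ τ in α..(1:ℝ), quantileFn ν τ

/-- A measure on `ℝ` with bounded support. -/
def HasBoundedSupport (ν : Measure ℝ) : Prop :=
  ∃ a b : ℝ, ν (Set.Icc a b)ᶜ = 0

/-- Finite Markov decision process with fixed state and action spaces. -/
structure MDP (X A : Type) [Fintype X] [Fintype A] where
  P : X → A → X → ℝ
  r : X → A → X → ℝ
  γ : ℝ
  P_nonneg : ∀ x a x', 0 ≤ P x a x'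
  P_sum_one : ∀ x a, ∑ x', P x a x' = 1
  γ_nonneg : 0 ≤ γ
  γ_lt_one : γ < 1

variable {X A : Type} [Fintype X] [Fintype A]

/-- A stationary Markovian policy. -/
def IsPolicy (π : X → A → ℝ) : Prop :=
  (∀ x a, 0 ≤ π x a) ∧ ∀ x, ∑ a, π x a = 1

/-- The discrete measure `(T^π D_{α,Q})^{(x,a)}`. -/
def diatomicMeasure (M : MDP X A) (α : ℝ) (π : X → A → ℝ)
    (Q : X → A → ℝ × ℝ) (x : X) (a : A) : Measure ℝ :=
  ∑ x' : X, ∑ a' : A, ENNReal.ofReal (M.P x a x' * π x' a') •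
    (ENNReal.ofReal α • Measure.dirac (M.r x a x' + M.γ * (Q x' a').1)
      + ENNReal.ofReal (1 - α) • Measure.dirac (M.r x a x' + M.γ * (Q x' a').2))

/-- The diatomic Bellman operator `T^π_α`. -/
def diatomicT (M : MDP X A) (α : ℝ) (π : X → A → ℝ)
    (Q : X → A → ℝ × ℝ) : X → A → ℝ × ℝ :=
  fun x a => (avarLeft α (diatomicMeasure M α π Q x a),
              avarRight α (diatomicMeasure M α π Q x a))

theorem HasBoundedSupport.add {μ ν : Measure ℝ} (hμ : HasBoundedSupport μ)
    (hν : HasBoundedSupport ν) : HasBoundedSupport (μ + ν) := by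
  obtain ⟨a, b, h⟩ := hμ
  obtain ⟨c, d, h'⟩ := hν
  refine ⟨min a c, max b d, ?_⟩
  rw [Measure.add_apply, add_eq_zero]
  exact ⟨measure_mono_null
      (compl_subset_compl.2 (Icc_subset_Icc (min_le_left _ _) (le_max_left _ _))) h,
    measure_mono_null
      (compl_subset_compl.2 (Icc_subset_Icc (min_le_right _ _) (le_max_right _ _))) h'⟩

theorem HasBoundedSupport.smul {μ : Measure ℝ} (hμ : HasBoundedSupport μ) (c : ENNReal) :
    HasBoundedSupport (c • μ) := by
  obtain ⟨a, b, h⟩ := hμ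
  exact ⟨a, b, by simp [h]⟩

theorem hasBoundedSupport_dirac (x : ℝ) : HasBoundedSupport (Measure.dirac x) :=
  ⟨x, x, by simp⟩

theorem hasBoundedSupport_sum {ι : Type*} (s : Finset ι) (μ : ι → Measure ℝ)
    (h : ∀ i ∈ s, HasBoundedSupport (μ i)) : HasBoundedSupport (∑ i ∈ s, μ i) :=
  Finset.sum_induction μ HasBoundedSupport (fun _ _ => HasBoundedSupport.add)
    ⟨0, 0, by simp⟩ h

section Quantile

variable {ν ν' : Measure ℝ} [IsProbabilityMeasure ν] [IsProbabilityMeasure ν'] {a b : ℝ}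

theorem le_of_le_cdf (h : ν (Set.Icc a b)ᶜ = 0) {τ z : ℝ} (hτ : 0 < τ) (hz : τ ≤ cdf ν z) :
    a ≤ z := by
  by_contra! hza
  have hsub : Set.Iic z ⊆ (Set.Icc a b)ᶜ := fun y hy hy' =>
    absurd (hy'.1.trans hy) (not_le.2 hza)
  have h0 : ν (Set.Iic z) = 0 := measure_mono_null hsub h
  rw [cdf_eq_real, measureReal_def, h0] at hz
  exact absurd hz (by simpa using hτ)

theorem cdf_eq_one_of_bounded (h : ν (Set.Icc a b)ᶜ = 0) : cdf ν b = 1 := by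
  have h0 : ν (Set.Iic b)ᶜ = 0 :=
    measure_mono_null (compl_subset_compl.2 fun y hy => hy.2) h
  rw [cdf_eq_real, measureReal_def, (prob_compl_eq_zero_iff measurableSet_Iic).1 h0]
  simp

theorem bddBelow_le_cdf (h : HasBoundedSupport ν) {τ : ℝ} (hτ : 0 < τ) :
    BddBelow {z : ℝ | τ ≤ cdf ν z} := by
  obtain ⟨a, b, h⟩ := h
  exact ⟨a, fun z hz => le_of_le_cdf h hτ hz⟩

theorem nonempty_le_cdf (h : HasBoundedSupport ν) {τ : ℝ} (hτ : τ ≤ 1) :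
    {z : ℝ | τ ≤ cdf ν z}.Nonempty := by
  obtain ⟨a, b, h⟩ := h
  exact ⟨b, hτ.trans (cdf_eq_one_of_bounded h).ge⟩

theorem monotoneOn_quantileFn (h : HasBoundedSupport ν) :
    MonotoneOn (quantileFn ν) (Set.Ioc 0 1) := fun _ hs _ ht hst =>
  csInf_le_csInf (bddBelow_le_cdf h hs.1) (nonempty_le_cdf h ht.2) fun _ hz => hst.trans hz

theorem integrableOn_quantileFn (h : HasBoundedSupport ν) :
    IntegrableOn (quantileFn ν) (Set.Ioc 0 1) := by
  obtain ⟨a, b, hab⟩ := id h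
  refine Integrable.of_bound (aemeasurable_restrict_of_monotoneOn measurableSet_Ioc
    (monotoneOn_quantileFn h)).aestronglyMeasurable (max |a| |b|) ?_
  refine ae_restrict_of_forall_mem measurableSet_Ioc fun τ hτ => ?_
  exact abs_le_max_abs_abs
    (le_csInf (nonempty_le_cdf h hτ.2) fun z hz => le_of_le_cdf hab hτ.1 hz)
    (csInf_le (bddBelow_le_cdf h hτ.1) (hτ.2.trans (cdf_eq_one_of_bounded hab).ge))

theorem quantileFn_le_add (h : HasBoundedSupport ν) (h' : HasBoundedSupport ν') {d : ℝ}
    (hd : ∀ z, cdf ν z ≤ cdf ν' (z + d)) {τ : ℝ} (hτ : τ ∈ Set.Ioc (0:ℝ) 1) :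
    quantileFn ν' τ ≤ quantileFn ν τ + d := by
  rw [← sub_le_iff_le_add]
  refine le_csInf (nonempty_le_cdf h hτ.2) fun z hz => ?_
  rw [sub_le_iff_le_add]
  exact csInf_le (bddBelow_le_cdf h' hτ.1) (le_trans hz (hd z))

theorem abs_integral_quantileFn_sub_le (h : HasBoundedSupport ν) (h' : HasBoundedSupport ν')
    {d : ℝ} (hd : ∀ z, cdf ν z ≤ cdf ν' (z + d)) (hd' : ∀ z, cdf ν' z ≤ cdf ν (z + d))
    {s t : ℝ} (hs : 0 ≤ s) (hst : s ≤ t) (ht : t ≤ 1) :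
    |(∫ τ in s..t, quantileFn ν τ) - ∫ τ in s..t, quantileFn ν' τ| ≤ d * (t - s) := by
  have hsub : Set.Ioc s t ⊆ Set.Ioc 0 1 := Set.Ioc_subset_Ioc hs ht
  have hi : ∀ {μ : Measure ℝ} [IsProbabilityMeasure μ], HasBoundedSupport μ →
      IntervalIntegrable (quantileFn μ) volume s t := fun hμ =>
    (intervalIntegrable_iff_integrableOn_Ioc_of_le hst).2
      ((integrableOn_quantileFn hμ).mono_set hsub)
  rw [← intervalIntegral.integral_sub (hi h) (hi h')]
  have := intervalIntegral.norm_integral_le_of_norm_le_const (a := s) (b := t) (C := d)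
    (f := fun τ => quantileFn ν τ - quantileFn ν' τ) fun τ hτ => by
      rw [Set.uIoc_of_le hst] at hτ
      have h1 := quantileFn_le_add h h' hd (hsub hτ)
      have h2 := quantileFn_le_add h' h hd' (hsub hτ)
      rw [Real.norm_eq_abs, abs_le]
      constructor <;> linarith
  rwa [Real.norm_eq_abs, abs_of_nonneg (sub_nonneg.2 hst)] at this

theorem abs_avarLeft_sub_le (h : HasBoundedSupport ν) (h' : HasBoundedSupport ν')
    {d : ℝ} (hd : ∀ z, cdf ν z ≤ cdf ν' (z + d)) (hd' : ∀ z, cdf ν' z ≤ cdf ν (z + d))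
    {α : ℝ} (hα : α ∈ Set.Ioo (0:ℝ) 1) : |avarLeft α ν - avarLeft α ν'| ≤ d := by
  have := abs_integral_quantileFn_sub_le h h' hd hd' le_rfl hα.1.le hα.2.le
  rw [avarLeft, avarLeft, ← mul_sub, abs_mul, abs_of_pos (one_div_pos.2 hα.1), one_div,
    inv_mul_le_iff₀ hα.1]
  linarith

theorem abs_avarRight_sub_le (h : HasBoundedSupport ν) (h' : HasBoundedSupport ν')
    {d : ℝ} (hd : ∀ z, cdf ν z ≤ cdf ν' (z + d)) (hd' : ∀ z, cdf ν' z ≤ cdf ν (z + d))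
    {α : ℝ} (hα : α ∈ Set.Ioo (0:ℝ) 1) : |avarRight α ν - avarRight α ν'| ≤ d := by
  have := abs_integral_quantileFn_sub_le h h' hd hd' hα.1.le hα.2.le le_rfl
  have hα' : 0 < 1 - α := sub_pos.2 hα.2
  rw [avarRight, avarRight, ← mul_sub, abs_mul, abs_of_pos (one_div_pos.2 hα'), one_div,
    inv_mul_le_iff₀ hα']
  linarith

end Quantile

theorem hasBoundedSupport_diatomicMeasure (M : MDP X A) (α : ℝ) (π : X → A → ℝ)
    (Q : X → A → ℝ × ℝ) (x : X) (a : A) : HasBoundedSupport (diatomicMeasure M α π Q x a) :=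
  hasBoundedSupport_sum _ _ fun _ _ => hasBoundedSupport_sum _ _ fun _ _ =>
    (((hasBoundedSupport_dirac _).smul _).add ((hasBoundedSupport_dirac _).smul _)).smul _

theorem isProbabilityMeasure_diatomicMeasure (M : MDP X A) {α : ℝ} (hα : α ∈ Set.Ioo (0:ℝ) 1)
    {π : X → A → ℝ} (hπ : IsPolicy π) (Q : X → A → ℝ × ℝ) (x : X) (a : A) :
    IsProbabilityMeasure (diatomicMeasure M α π Q x a) := by
  constructor
  have hα' : ENNReal.ofReal α + ENNReal.ofReal (1 - α) = 1 := by
    rw [← ENNReal.ofReal_add hα.1.le (sub_nonneg.2 hα.2.le)]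
    simp
  have hw : ∀ x' a', 0 ≤ M.P x a x' * π x' a' := fun x' a' =>
    mul_nonneg (M.P_nonneg _ _ _) (hπ.1 _ _)
  simp only [diatomicMeasure, Measure.finsetSum_apply, Measure.smul_apply, Measure.add_apply,
    measure_univ, smul_eq_mul, mul_one, hα']
  simp_rw [← ENNReal.ofReal_sum_of_nonneg fun a' _ => hw _ a', ← Finset.mul_sum, hπ.2, mul_one]
  rw [← ENNReal.ofReal_sum_of_nonneg fun x' _ => M.P_nonneg _ _ _, M.P_sum_one,
    ENNReal.ofReal_one]

theorem cdf_diatomicMeasure_le (M : MDP X A) {α : ℝ} (hα : α ∈ Set.Ioo (0:ℝ) 1)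
    {π : X → A → ℝ} (hπ : IsPolicy π) (Q Q' : X → A → ℝ × ℝ) (x : X) (a : A) (z : ℝ) :
    cdf (diatomicMeasure M α π Q x a) z ≤
      cdf (diatomicMeasure M α π Q' x a) (z + M.γ * dist Q Q') := by
  have := isProbabilityMeasure_diatomicMeasure M hα hπ Q x a
  have := isProbabilityMeasure_diatomicMeasure M hα hπ Q' x a
  have hdirac : ∀ {c u u' : ℝ}, dist u u' ≤ dist Q Q' →
      Measure.dirac (c + M.γ * u) (Set.Iic z) ≤
        Measure.dirac (c + M.γ * u') (Set.Iic (z + M.γ * dist Q Q')) := by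
    intro c u u' hu
    have hle : u' - u ≤ dist Q Q' := by
      rw [Real.dist_eq] at hu
      linarith [neg_le_abs (u - u')]
    have hγ := mul_le_mul_of_nonneg_left hle M.γ_nonneg
    by_cases hz : c + M.γ * u ≤ z
    · have hz' : c + M.γ * u' ≤ z + M.γ * dist Q Q' := by linarith
      simpa [Set.indicator, hz'] using ite_le_one le_rfl zero_le_one
    · simp [Set.indicator, hz]
  rw [cdf_eq_real, cdf_eq_real]
  refine ENNReal.toReal_mono (measure_ne_top _ _) ?_
  have hQ : ∀ x' a', dist (Q x' a') (Q' x' a') ≤ dist Q Q' := fun x' a' =>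
    (dist_le_pi_dist (Q x') (Q' x') a').trans (dist_le_pi_dist Q Q' x')
  simp only [diatomicMeasure, Measure.finsetSum_apply, Measure.smul_apply, Measure.add_apply,
    smul_eq_mul]
  refine Finset.sum_le_sum fun x' _ => Finset.sum_le_sum fun a' _ => ?_
  have h₁ := hdirac (c := M.r x a x') ((le_max_left _ _).trans (hQ x' a'))
  have h₂ := hdirac (c := M.r x a x') ((le_max_right _ _).trans (hQ x' a'))
  exact mul_le_mul_right (add_le_add (mul_le_mul_right h₁ _) (mul_le_mul_right h₂ _)) _

theorem contractingWith_diatomicT (M : MDP X A) {α : ℝ} (hα : α ∈ Set.Ioo (0:ℝ) 1)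
    {π : X → A → ℝ} (hπ : IsPolicy π) :
    ContractingWith ⟨M.γ, M.γ_nonneg⟩ (diatomicT M α π) := by
  refine ⟨M.γ_lt_one, LipschitzWith.of_dist_le_mul fun Q Q' => ?_⟩
  have h0 : 0 ≤ M.γ * dist Q Q' := mul_nonneg M.γ_nonneg dist_nonneg
  refine (dist_pi_le_iff h0).2 fun x => (dist_pi_le_iff h0).2 fun a => ?_
  have := isProbabilityMeasure_diatomicMeasure M hα hπ Q x a
  have := isProbabilityMeasure_diatomicMeasure M hα hπ Q' x a
  have h := hasBoundedSupport_diatomicMeasure M α π Q x a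
  have h' := hasBoundedSupport_diatomicMeasure M α π Q' x a
  have hd := cdf_diatomicMeasure_le M hα hπ Q Q' x a
  have hd' := cdf_diatomicMeasure_le M hα hπ Q' Q x a
  rw [dist_comm Q' Q] at hd'
  exact max_le (abs_avarLeft_sub_le h h' hd hd' hα) (abs_avarRight_sub_le h h' hd hd' hα)

theorem stmt7 (M : MDP X A) (α : ℝ) (hα : α ∈ Set.Ioo (0:ℝ) 1)
    (π : X → A → ℝ) (hπ : IsPolicy π) :
    ∃! Q : X → A → ℝ × ℝ, diatomicT M α π Q = Q := by
  have h := contractingWith_diatomicT M hα hπ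
  exact ⟨h.fixedPoint, h.fixedPoint_isFixedPt, fun Q hQ => h.fixedPoint_unique hQ⟩

end
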